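/- arXiv:2009.07051 — 3 statements merged into one kernel-verified Lean document; each statement's English description precedes it below -/
import Mathlib

section
/- Let u be a linear functional on complex polynomials and let φ, ψ be polynomials. Then D_{q,ω}(φ·u) = ψ·u holds if and only if D_{1/q,−ω/q}(φ̂·u) = ψ·u holds, where φ̂(x) := q^{−1}[ φ(x) + ((q−1)x+ω) ψ(x) ]. Consequently, a regular functional u is D_{q,ω}-semiclassical if and only if it is D_{1/q,−ω/q}-semiclassical. -/
open Polynomial Finset

noncomputable section

namespace DiscreteCoherent

/-- The Hahn operator `D_{q,ω}` acting on polynomials: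
`(D_{q,ω} f)(x) = (f(qx+ω) − f(x))/((q−1)x+ω)`.
Since `(q−1)x+ω = (q−1)(x − ω/(1−q))`, the (exact) division is performed
via division by the monic polynomial `X − C (ω/(1−q))`. -/
def hahnD (q ω : ℂ) (f : Polynomial ℂ) : Polynomial ℂ :=
  (q - 1)⁻¹ • ((f.comp (C q * X + C ω) - f) /ₘ (X - C (ω / (1 - q))))

/-- The shift operator `L_{q,ω}` on polynomials: `(L_{q,ω} f)(x) = f(qx+ω)`. -/
def shiftL (q ω : ℂ) (f : Polynomial ℂ) : Polynomial ℂ := f.comp (C q * X + C ω)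

/-- Functionals on complex polynomials (linearity is assumed separately). -/
abbrev PolyFun := Polynomial ℂ → ℂ

/-- Left multiplication of a functional by a polynomial: `⟨g·u, f⟩ = ⟨u, g f⟩`. -/
def pmul (g : Polynomial ℂ) (u : PolyFun) : PolyFun := fun f => u (g * f)

/-- The operator `D_{q,ω}` on functionals: `⟨D_{q,ω} u, f⟩ = −q⁻¹ ⟨u, D_{1/q,−ω/q} f⟩`. -/
def fD (q ω : ℂ) (u : PolyFun) : PolyFun := fun f => -q⁻¹ * u (hahnD q⁻¹ (-ω / q) f)

/-- The operator `L_{q,ω}` on functionals: `⟨L_{q,ω} u, f⟩ = ⟨u, L_{1/q,−ω/q} f⟩`. -/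
def fL (q ω : ℂ) (u : PolyFun) : PolyFun := fun f => u (shiftL q⁻¹ (-ω / q) f)

/-- `[n]_q = (q^n − 1)/(q − 1)`. -/
def qNum (q : ℂ) (n : ℕ) : ℂ := (q ^ n - 1) / (q - 1)

/-- `[n]_q! = ∏_{j=1}^n [j]_q`. -/
def qFact (q : ℂ) (n : ℕ) : ℂ := ∏ j ∈ Finset.range n, qNum q (j + 1)

/-- The Gaussian binomial coefficient `[n choose k]_q`. -/
def qBinom (q : ℂ) (n k : ℕ) : ℂ := qFact q n / (qFact q k * qFact q (n - k))

/-- `(P_n)` is the monic OPS with respect to the (regular) linear functional `u`. -/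
structure IsMonicOPS (u : PolyFun) (P : ℕ → Polynomial ℂ) : Prop where
  lin : IsLinearMap ℂ u
  monic : ∀ n, (P n).Monic
  natDegree_eq : ∀ n, (P n).natDegree = n
  orth : ∀ m n, m ≠ n → u (P m * P n) = 0
  sq_ne : ∀ n, u (P n ^ 2) ≠ 0

/-- A linear functional is regular if it admits a monic OPS. -/
def IsRegular (u : PolyFun) : Prop := ∃ P, IsMonicOPS u P

/-- The normalized discrete derivatives `P_n^{[m]} = ([n]_q!/[n+m]_q!) D_{q,ω}^m P_{n+m}`. -/
def dps (q ω : ℂ) (P : ℕ → Polynomial ℂ) (m n : ℕ) : Polynomial ℂ :=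
  (qFact q n / qFact q (n + m)) • ((hahnD q ω)^[m] (P (n + m)))

/-- `((P_n),(Q_n))` is a `π_N`-`(q,ω)`-coherent pair with index `M` and order `(m,k)`,
with coefficients `c`.  The convention `Q_j ≡ 0` for `j < 0` is realized by the
truncated subtraction `n - M` in the lower summation limit. -/
structure IsCoherentPair (q ω : ℂ) (P Q : ℕ → Polynomial ℂ) (piN : Polynomial ℂ)
    (M N m k : ℕ) (c : ℕ → ℕ → ℂ) : Prop where
  monic_pi : piN.Monic
  natDegree_pi : piN.natDegree = N
  struct : ∀ n, piN * dps q ω P m n =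
    ∑ j ∈ Finset.Icc (n - M) (n + N), c n j • dps q ω Q k j
  lead : ∀ n, c n (n + N) = 1
  coeff_ne : ∀ n, M ≤ n → c n (n - M) ≠ 0

/-- The polynomial `ψ(·;n)`; terms with negative indices are omitted (truncated
subtraction in the lower summation limit). -/
def psiP (q : ℂ) (u : PolyFun) (P : ℕ → Polynomial ℂ) (c : ℕ → ℕ → ℂ)
    (M N m : ℕ) (n : ℕ) : Polynomial ℂ :=
  ∑ j ∈ Finset.Icc (n - N) (n + M),
    ((-q) ^ m * qFact q (j + m) / (qFact q j * u (P (m + j) ^ 2)) * c j n) • P (m + j)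

/-- The polynomial `φ(·;n,j)`. -/
def phiP (q ω : ℂ) (v : PolyFun) (Q : ℕ → Polynomial ℂ) (piN : Polynomial ℂ)
    (N k : ℕ) (n j : ℕ) : Polynomial ℂ :=
  ((-q) ^ k * qFact q (n + k) / (qFact q n * v (Q (n + k) ^ 2))) •
    ∑ l ∈ Finset.range (N - j + 1),
      (qBinom q⁻¹ (k + n) l * qBinom q⁻¹ (N - l) (N - j - l)) •
        ((shiftL q⁻¹ (-ω / q))^[k + N - l] ((hahnD q⁻¹ (-ω / q))^[l] piN) *
          (shiftL q⁻¹ (-ω / q))^[j] ((hahnD q⁻¹ (-ω / q))^[n - j - l] (Q (n + k))))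

/-- `u` is a `D_{q,ω}`-semiclassical functional. -/
def IsSemiclassical (q ω : ℂ) (u : PolyFun) : Prop :=
  ∃ phi psi : Polynomial ℂ, phi ≠ 0 ∧ psi ≠ 0 ∧ 1 ≤ psi.natDegree ∧
    fD q ω (pmul phi u) = pmul psi u

/-- The class `s(u)` of a `D_{q,ω}`-semiclassical functional. -/
def semiClass (q ω : ℂ) (u : PolyFun) : ℕ :=
  sInf {s | ∃ phi psi : Polynomial ℂ, phi ≠ 0 ∧ psi ≠ 0 ∧ 1 ≤ psi.natDegree ∧
    fD q ω (pmul phi u) = pmul psi u ∧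
    max (phi.natDegree - 2) (psi.natDegree - 1) = s}

end DiscreteCoherent
namespace DiscreteCoherent

lemma X_sub_C_mul_divByMonic_shift_sub (q ω : ℂ) (hq1 : q ≠ 1) (f : Polynomial ℂ) :
    (X - C (ω / (1 - q))) * ((f.comp (C q * X + C ω) - f) /ₘ (X - C (ω / (1 - q)))) =
      f.comp (C q * X + C ω) - f := by
  rw [mul_divByMonic_eq_iff_isRoot, IsRoot.def, eval_sub, eval_comp]
  have h : 1 - q ≠ 0 := sub_ne_zero.mpr hq1.symm
  have e : eval (ω / (1 - q)) (C q * X + C ω) = ω / (1 - q) := by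
    simp only [eval_add, eval_mul, eval_C, eval_X]
    field_simp
    ring
  rw [e, sub_self]

lemma linear_eq_C_mul_X_sub_C (q ω : ℂ) (hq1 : q ≠ 1) :
    C (q - 1) * X + C ω = C (q - 1) * (X - C (ω / (1 - q))) := by
  have h : 1 - q ≠ 0 := sub_ne_zero.mpr hq1.symm
  have e : (q - 1) * (ω / (1 - q)) = -ω := by
    field_simp
    ring
  rw [mul_sub, ← C_mul, e, C_neg, sub_neg_eq_add]

/-- The defining identity of the Hahn operator. -/
lemma linear_mul_hahnD (q ω : ℂ) (hq1 : q ≠ 1) (f : Polynomial ℂ) :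
    (C (q - 1) * X + C ω) * hahnD q ω f = shiftL q ω f - f := by
  rw [linear_eq_C_mul_X_sub_C q ω hq1, hahnD, mul_smul_comm, mul_assoc,
    X_sub_C_mul_divByMonic_shift_sub q ω hq1, smul_eq_C_mul, ← mul_assoc, ← C_mul,
    inv_mul_cancel₀ (sub_ne_zero.mpr hq1), C_1, one_mul, shiftL]

lemma shiftL_shiftL_inv (q ω : ℂ) (hq0 : q ≠ 0) (f : Polynomial ℂ) :
    shiftL q ω (shiftL q⁻¹ (-ω / q) f) = f := by
  have e : (C q⁻¹ * X + C (-ω / q)).comp (C q * X + C ω) = X := by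
    simp only [add_comp, mul_comp, C_comp, X_comp]
    rw [mul_add, ← mul_assoc, ← C_mul, ← C_mul, inv_mul_cancel₀ hq0, add_assoc, ← C_add]
    have : q⁻¹ * ω + -ω / q = 0 := by ring
    simp [this]
  rw [shiftL, shiftL, comp_assoc, e, comp_X]

lemma neg_neg_div_div_inv (q ω : ℂ) (hq0 : q ≠ 0) : -(-ω / q) / q⁻¹ = ω := by
  field_simp

lemma shiftL_inv_shiftL (q ω : ℂ) (hq0 : q ≠ 0) (f : Polynomial ℂ) :
    shiftL q⁻¹ (-ω / q) (shiftL q ω f) = f := by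
  simpa only [inv_inv, neg_neg_div_div_inv q ω hq0] using
    shiftL_shiftL_inv q⁻¹ (-ω / q) (inv_ne_zero hq0) f

lemma hahnD_inv_shiftL (q ω : ℂ) (hq0 : q ≠ 0) (hq1 : q ≠ 1) (f : Polynomial ℂ) :
    hahnD q⁻¹ (-ω / q) (shiftL q ω f) = q • hahnD q ω f := by
  have h1 := linear_mul_hahnD q ω hq1 f
  have h2 := linear_mul_hahnD q⁻¹ (-ω / q) (by simpa using hq1) (shiftL q ω f)
  rw [shiftL_inv_shiftL q ω hq0] at h2
  have e : C (q⁻¹ - 1) * X + C (-ω / q) = -(C q⁻¹ * (C (q - 1) * X + C ω)) := by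
    rw [mul_add, ← mul_assoc, ← C_mul, ← C_mul, neg_add, ← neg_mul, ← C_neg, ← C_neg]
    congr 3
    · field_simp
      ring
    · ring
  have hne : C (q - 1) * X + C ω ≠ 0 := by
    rw [linear_eq_C_mul_X_sub_C q ω hq1]
    exact mul_ne_zero (C_ne_zero.mpr (sub_ne_zero.mpr hq1)) (X_sub_C_ne_zero _)
  have hc : C q * C q⁻¹ = (1 : Polynomial ℂ) := by
    rw [← C_mul, mul_inv_cancel₀ hq0, C_1]
  rw [e] at h2
  apply mul_left_cancel₀ hne
  rw [smul_eq_C_mul]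
  linear_combination (-C q) * h2 - C q * h1 -
    (C (q - 1) * X + C ω) * hahnD q⁻¹ (-ω / q) (shiftL q ω f) * hc

theorem fD_pmul_eq_iff_inv (q ω : ℂ) (hq0 : q ≠ 0) (hq1 : q ≠ 1) (u : PolyFun)
    (hu : IsLinearMap ℂ u) (phi psi : Polynomial ℂ) :
    fD q ω (pmul phi u) = pmul psi u ↔
      fD q⁻¹ (-ω / q) (pmul (q⁻¹ • (phi + (C (q - 1) * X + C ω) * psi)) u) = pmul psi u := by
  have key (f : Polynomial ℂ) :
      fD q ω (pmul phi u) (shiftL q ω f) = pmul psi u (shiftL q ω f) ↔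
      fD q⁻¹ (-ω / q) (pmul (q⁻¹ • (phi + (C (q - 1) * X + C ω) * psi)) u) f =
        pmul psi u f := by
    have e : (phi + (C (q - 1) * X + C ω) * psi) * hahnD q ω f =
        phi * hahnD q ω f + (psi * shiftL q ω f - psi * f) := by
      linear_combination psi * linear_mul_hahnD q ω hq1 f
    simp only [fD, pmul, inv_inv, neg_neg_div_div_inv q ω hq0, hahnD_inv_shiftL q ω hq0 hq1,
      smul_mul_assoc, mul_smul_comm, e, hu.map_smul, hu.map_add, hu.map_sub, smul_eq_mul]
    rw [neg_mul, inv_mul_cancel_left₀ hq0, neg_mul, mul_inv_cancel_left₀ hq0]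
    constructor <;> intro h <;> linear_combination h
  constructor
  · intro h
    funext f
    exact (key f).mp (congrFun h _)
  · intro h
    funext f
    have := (key (shiftL q⁻¹ (-ω / q) f)).mpr (congrFun h _)
    rwa [shiftL_shiftL_inv q ω hq0] at this

lemma IsMonicOPS.degree_sub_leadingCoeff_mul_lt {u : PolyFun} {P : ℕ → Polynomial ℂ}
    (hP : IsMonicOPS u P) {r : Polynomial ℂ} (hr : r ≠ 0) :
    (r - C r.leadingCoeff * P r.natDegree).degree < r.degree := by
  apply degree_sub_lt_left _ hr
  · rw [leadingCoeff_mul, leadingCoeff_C, (hP.monic _).leadingCoeff, mul_one]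
  · rw [degree_C_mul (leadingCoeff_ne_zero.mpr hr), degree_eq_natDegree hr,
      degree_eq_natDegree (hP.monic _).ne_zero, hP.natDegree_eq]

lemma IsMonicOPS.apply_mul_eq_zero {u : PolyFun} {P : ℕ → Polynomial ℂ} (hP : IsMonicOPS u P)
    {n : ℕ} {r : Polynomial ℂ} (hr : r.degree < n) : u (r * P n) = 0 := by
  induction h : r.degree using WellFoundedLT.induction generalizing r with
  | ind d ih =>
    subst h
    by_cases h0 : r = 0
    · rw [h0, zero_mul, hP.lin.map_zero]
    have hlt : (r - C r.leadingCoeff * P r.natDegree).degree < r.degree :=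
      hP.degree_sub_leadingCoeff_mul_lt h0
    have h1 := ih _ hlt (hlt.trans hr) rfl
    have hne : r.natDegree ≠ n := by
      rintro rfl
      exact (degree_eq_natDegree h0).not_lt hr
    have e : r * P n = (r - C r.leadingCoeff * P r.natDegree) * P n +
        r.leadingCoeff • (P r.natDegree * P n) := by
      rw [smul_eq_C_mul]
      ring
    rw [e, hP.lin.map_add, hP.lin.map_smul, h1, hP.orth _ _ hne, smul_zero, add_zero]

/-- A regular functional is not annihilated by any nonzero polynomial. -/
lemma IsRegular.exists_apply_mul_ne_zero {u : PolyFun} (hu : IsRegular u) {g : Polynomial ℂ}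
    (hg : g ≠ 0) : ∃ f, u (g * f) ≠ 0 := by
  obtain ⟨P, hP⟩ := hu
  refine ⟨P g.natDegree, ?_⟩
  have hlt := hP.degree_sub_leadingCoeff_mul_lt hg
  rw [degree_eq_natDegree hg] at hlt
  have e : g * P g.natDegree = (g - C g.leadingCoeff * P g.natDegree) * P g.natDegree +
      g.leadingCoeff • P g.natDegree ^ 2 := by
    rw [smul_eq_C_mul]
    ring
  rw [e, hP.lin.map_add, hP.lin.map_smul, hP.apply_mul_eq_zero hlt, zero_add]
  exact smul_ne_zero (leadingCoeff_ne_zero.mpr hg) (hP.sq_ne _)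

lemma IsSemiclassical.inv {q ω : ℂ} (hq0 : q ≠ 0) (hq1 : q ≠ 1) {u : PolyFun}
    (hu : IsRegular u) (h : IsSemiclassical q ω u) : IsSemiclassical q⁻¹ (-ω / q) u := by
  have hlin : IsLinearMap ℂ u := hu.choose_spec.lin
  obtain ⟨phi, psi, -, hpsi, hdeg, h⟩ := h
  rw [fD_pmul_eq_iff_inv q ω hq0 hq1 u hlin] at h
  refine ⟨_, psi, fun h0 => ?_, hpsi, hdeg, h⟩
  obtain ⟨f, hf⟩ := hu.exists_apply_mul_ne_zero hpsi
  refine hf ((congrFun h f).symm.trans ?_)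
  rw [h0, fD, pmul, zero_mul, hlin.map_zero, mul_zero]

/-- `D_{q,ω}(φ·u) = ψ·u` iff `D_{1/q,−ω/q}(φ̂·u) = ψ·u`, with
`φ̂(x) = q⁻¹[φ(x) + ((q−1)x+ω)ψ(x)]`; consequently a regular functional is
`D_{q,ω}`-semiclassical iff it is `D_{1/q,−ω/q}`-semiclassical. -/
theorem semiclassical_iff_inv (q ω : ℂ) (hq0 : q ≠ 0)
    (hq : ∀ n : ℕ, 1 ≤ n → q ^ n ≠ 1) :
    (∀ (u : PolyFun), IsLinearMap ℂ u → ∀ phi psi : Polynomial ℂ,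
      (fD q ω (pmul phi u) = pmul psi u ↔
        fD q⁻¹ (-ω / q)
          (pmul (q⁻¹ • (phi + (C (q - 1) * X + C ω) * psi)) u) = pmul psi u)) ∧
    (∀ (u : PolyFun), IsRegular u →
      (IsSemiclassical q ω u ↔ IsSemiclassical q⁻¹ (-ω / q) u)) := by
  have hq1 : q ≠ 1 := by simpa using hq 1 le_rfl
  refine ⟨fun u hu phi psi => fD_pmul_eq_iff_inv q ω hq0 hq1 u hu phi psi,
    fun u hu => ⟨fun h => h.inv hq0 hq1 hu, fun h => ?_⟩⟩
  simpa only [inv_inv, neg_neg_div_div_inv q ω hq0] using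
    h.inv (inv_ne_zero hq0) (by simpa using hq1) hu

end DiscreteCoherent
end
end

section
/- Let (P_n)_{n≥0} be a monic OPS with respect to a regular functional u, satisfying the three-term recurrence xP_n = P_{n+1} + β_n P_n + γ_n P_{n−1}, set ω₀ = ω/(1−q), and suppose that for some c ∈ ℂ and complex numbers c_{n,n} ≠ 0 the structure relation (x − ω₀ + c) (D_{q,ω} P_{n+1})(x) = [n+1]_q ( P_{n+1}(x) + c_{n,n} P_n(x) ) holds for all n ≥ 0. Then c + β₀ ≠ ω₀, and with α := −q(β₀ − ω₀ + c)/γ₁ and β := α(ω₀ − β₀), the functional u satisfies D_{1/q,−ω/q}( (x − ω₀ + c)·u ) = ( α(x − ω₀) + β )·u. -/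
open Polynomial Finset

noncomputable section

namespace DiscreteCoherent

lemma add_divByMonic {R : Type*} [CommRing R] {q : R[X]} (hq : q.Monic) (f g : R[X]) :
    (f + g) /ₘ q = f /ₘ q + g /ₘ q := by
  nontriviality R
  refine (div_modByMonic_unique _ (f %ₘ q + g %ₘ q) hq ⟨?_, ?_⟩).1
  · linear_combination modByMonic_add_div f q + modByMonic_add_div g q
  · exact (degree_add_le _ _).trans_lt
      (max_lt (degree_modByMonic_lt f hq) (degree_modByMonic_lt g hq))

lemma smul_divByMonic {R : Type*} [CommRing R] {q : R[X]} (hq : q.Monic) (a : R) (f : R[X]) :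
    (a • f) /ₘ q = a • (f /ₘ q) := by
  nontriviality R
  refine (div_modByMonic_unique _ (a • (f %ₘ q)) hq ⟨?_, ?_⟩).1
  · rw [mul_smul_comm, ← smul_add, modByMonic_add_div]
  · exact (degree_smul_le _ _).trans_lt (degree_modByMonic_lt f hq)

lemma hahnD_add (q ω : ℂ) (f g : Polynomial ℂ) :
    hahnD q ω (f + g) = hahnD q ω f + hahnD q ω g := by
  rw [hahnD, hahnD, hahnD, ← smul_add, ← add_divByMonic (monic_X_sub_C _), add_comp, add_sub_add_comm]

lemma hahnD_smul (q ω a : ℂ) (f : Polynomial ℂ) :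
    hahnD q ω (a • f) = a • hahnD q ω f := by
  rw [hahnD, hahnD, smul_comp, ← smul_sub, smul_divByMonic (monic_X_sub_C _), smul_comm]

lemma hahnD_C (q ω a : ℂ) : hahnD q ω (C a) = 0 := by
  simp [hahnD]

lemma hahnD_X {q : ℂ} (ω : ℂ) (hq : q ≠ 1) : hahnD q ω X = 1 := by
  have h : q - 1 ≠ 0 := sub_ne_zero.mpr hq
  have h' : 1 - q ≠ 0 := sub_ne_zero.mpr hq.symm
  have hω : ω = -((q - 1) * (ω / (1 - q))) := by field_simp; ring
  have key : (C q * X + C ω - X : Polynomial ℂ) = (X - C (ω / (1 - q))) * C (q - 1) := by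
    conv_lhs => rw [hω]
    simp only [C_neg, C_mul, C_sub, C_1]
    ring
  rw [hahnD, X_comp, key, mul_divByMonic_cancel_left _ (monic_X_sub_C _), smul_C, smul_eq_mul,
    inv_mul_cancel₀ h, C_1]

/-- Linear functionals agreeing on a sequence of monic polynomials of every degree are equal. -/
lemma eq_of_eq_on_monic_sequence {P : ℕ → Polynomial ℂ} (hmonic : ∀ n, (P n).Monic)
    (hdeg : ∀ n, (P n).natDegree = n) {v w : PolyFun} (hv : IsLinearMap ℂ v)
    (hw : IsLinearMap ℂ w) (h : ∀ n, v (P n) = w (P n)) : v = w := by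
  let S : Polynomial.Sequence ℂ :=
    ⟨P, fun n => by rw [degree_eq_natDegree (hmonic n).ne_zero, hdeg]⟩
  have hspan : Submodule.span ℂ (Set.range P) = ⊤ :=
    S.span fun n => by
      have : (P n).leadingCoeff = 1 := hmonic n
      change IsUnit (P n).leadingCoeff
      rw [this]
      exact isUnit_one
  have key : hv.mk' v = hw.mk' w :=
    LinearMap.ext_on_range hspan h
  funext f
  exact LinearMap.congr_fun key f

/-- **Case N = 1 of Theorem 3.1 (functional equation).** If
`(x − ω₀ + c) D_{q,ω}P_{n+1} = [n+1]_q (P_{n+1} + c_{n,n} P_n)` with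
`c_{n,n} ≠ 0`, then `c + β₀ ≠ ω₀` and, with `α = −q(β₀ − ω₀ + c)/γ₁` and
`β = α(ω₀ − β₀)`, `D_{1/q,−ω/q}((x − ω₀ + c)·u) = (α(x − ω₀) + β)·u`. -/
theorem case_N_one_functional_equation (q ω : ℂ) (hq0 : q ≠ 0)
    (hq : ∀ n : ℕ, 1 ≤ n → q ^ n ≠ 1)
    (u : PolyFun) (P : ℕ → Polynomial ℂ) (hu : IsMonicOPS u P)
    (β γ : ℕ → ℂ) (hγ : ∀ n, 1 ≤ n → γ n ≠ 0)
    (hrec0 : X * P 0 = P 1 + C (β 0) * P 0)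
    (hrec : ∀ n, X * P (n + 1) = P (n + 2) + C (β (n + 1)) * P (n + 1) + C (γ (n + 1)) * P n)
    (ω₀ : ℂ) (hω₀ : ω₀ = ω / (1 - q))
    (c : ℂ) (cn : ℕ → ℂ) (hcn : ∀ n, cn n ≠ 0)
    (hrel : ∀ n, (X - C ω₀ + C c) * hahnD q ω (P (n + 1)) =
      qNum q (n + 1) • (P (n + 1) + cn n • P n))
    (α βc : ℂ) (hα : α = -(q * (β 0 - ω₀ + c)) / γ 1) (hβc : βc = α * (ω₀ - β 0)) :
    c + β 0 ≠ ω₀ ∧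
    fD q⁻¹ (-ω / q) (pmul (X - C ω₀ + C c) u) =
      pmul (C α * (X - C ω₀) + C βc) u := by
  have hq1 : q ≠ 1 := by simpa using hq 1 le_rfl
  have hP0 : P 0 = 1 := (hu.monic 0).natDegree_eq_zero.mp (hu.natDegree_eq 0)
  have hP1 : P 1 = X - C (β 0) := by
    rw [hP0, mul_one, mul_one] at hrec0
    rw [hrec0, add_sub_cancel_right]
  have hqNum : qNum q 1 = 1 := by
    rw [qNum, pow_one, div_self (sub_ne_zero.mpr hq1)]
  have hc0 : cn 0 = β 0 - ω₀ + c := by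
    have h := hrel 0
    have hD : hahnD q ω (X - C (β 0)) = 1 := by
      rw [sub_eq_add_neg, ← C_neg, hahnD_add, hahnD_X ω hq1, hahnD_C, add_zero]
    rw [zero_add, hP1, hD, hqNum, one_smul, hP0] at h
    have := congrArg (eval 0) h
    simp at this
    linear_combination -this
  refine ⟨fun h => hcn 0 (by rw [hc0, ← h]; ring), ?_⟩
  have hfD (f : Polynomial ℂ) : fD q⁻¹ (-ω / q) (pmul (X - C ω₀ + C c) u) f =
      -q * u ((X - C ω₀ + C c) * hahnD q ω f) := by
    have hω : -(-ω / q) / q⁻¹ = ω := by field_simp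
    simp only [fD, pmul, inv_inv, hω]
  have hψ : C α * (X - C ω₀) + C βc = α • P 1 := by
    rw [hβc, hP1, smul_eq_C_mul]
    simp only [C_mul, C_sub]
    ring
  have hnorm : u (P 1 * P 1) = γ 1 * u (P 0 * P 0) := by
    have h1 : P 1 * P 1 = P 2 * P 0 + (β 1 - β 0) • (P 1 * P 0) + γ 1 • (P 0 * P 0) := by
      have h := hrec 0
      simp only [zero_add] at h
      simp only [smul_eq_C_mul, C_sub]
      linear_combination P 0 * h - P 1 * hrec0
    rw [h1, hu.lin.map_add, hu.lin.map_add, hu.lin.map_smul, hu.lin.map_smul,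
      hu.orth 2 0 (by norm_num), hu.orth 1 0 (by norm_num)]
    simp
  have hu0 (n : ℕ) (hn : n ≠ 0) : u (P n) = 0 := by
    simpa [hP0] using hu.orth n 0 hn
  refine eq_of_eq_on_monic_sequence hu.monic hu.natDegree_eq ⟨fun f g => ?_, fun a f => ?_⟩
    ⟨fun f g => ?_, fun a f => ?_⟩ fun n => ?_
  · rw [hfD, hfD, hfD, hahnD_add, mul_add, hu.lin.map_add, mul_add]
  · rw [hfD, hfD, hahnD_smul, mul_smul_comm, hu.lin.map_smul, smul_eq_mul, smul_eq_mul]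
    ring
  · simp only [pmul]
    rw [mul_add, hu.lin.map_add]
  · simp only [pmul]
    rw [mul_smul_comm, hu.lin.map_smul]
  · rw [hfD, hψ, pmul, smul_mul_assoc, hu.lin.map_smul, smul_eq_mul]
    rcases n with _ | n
    · rw [hu.orth 1 0 one_ne_zero, hP0, ← C_1, hahnD_C, mul_zero, hu.lin.map_zero, mul_zero,
        mul_zero]
    · rw [hrel, hu.lin.map_smul, hu.lin.map_add, hu.lin.map_smul, hu0 (n + 1) n.succ_ne_zero]
      rcases n with _ | n
      · have hγ1 := hγ 1 le_rfl
        rw [zero_add, hnorm, hqNum, hα, hc0, hP0, mul_one]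
        simp only [smul_eq_mul]
        field_simp
        ring
      · rw [hu0 (n + 1) n.succ_ne_zero, hu.orth 1 (n + 1 + 1) (by omega)]
        simp

end DiscreteCoherent
end
end

section
/- Let (P_n)_{n≥0} be a monic OPS with respect to a regular functional u, set ω₀ = ω/(1−q) and π₂(x) = (x − ω₀ − r)(x − ω₀ − s), and suppose π₂(x)(D_{q,ω} P_{n+1})(x) = [n+1]_q ( P_{n+2}(x) + c_{n,n+1} P_{n+1}(x) + c_{n,n} P_n(x) ) holds for all n ≥ 0 with c_{n,n} ≠ 0. Set α := −q(γ₁ + π₂(β₀))/γ₁ and β := −α(β₀ − ω₀). If α = 1/(1 − q^{−1}), then with c := (q−1)β + q(r+s) one has P_n(x) = L_n(x − ω₀; r, s, c | q^{−1}) for all n ≥ 0. -/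
open Polynomial Finset

noncomputable section

namespace DiscreteCoherent

/-- The monic polynomial sequence determined by a three-term recurrence
`x R_n = R_{n+1} + β_n R_n + γ_n R_{n−1}` with `R_{−1} = 0`, `R_0 = 1`. -/
def ttrSeq (β γ : ℕ → ℂ) : ℕ → Polynomial ℂ
  | 0 => 1
  | 1 => X - C (β 0)
  | n + 2 => (X - C (β (n + 1))) * ttrSeq β γ (n + 1) - C (γ (n + 1)) * ttrSeq β γ n

/-- Recurrence coefficient `β_n` for `L_n(·;a,b,c|q)`. -/
def Lbeta (q a b c : ℂ) (n : ℕ) : ℂ := (a + b - c * (q ^ (n + 1) + q ^ n - 1)) * q ^ n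

/-- Recurrence coefficient `γ_n` for `L_n(·;a,b,c|q)`:
`γ_{n+1} = −(a − cq^{n+1})(b − cq^{n+1})(1 − q^{n+1})q^n`. -/
def Lgamma (q a b c : ℂ) (n : ℕ) : ℂ :=
  -((a - c * q ^ n) * (b - c * q ^ n) * (1 - q ^ n) * q ^ (n - 1))

/-- The monic OPS `(L_n(·;a,b,c|q))_{n≥0}`. -/
def Lpoly (q a b c : ℂ) : ℕ → Polynomial ℂ := ttrSeq (Lbeta q a b c) (Lgamma q a b c)

/-- Recurrence coefficient `β_n` for `J_n(·;a,b,c,d|q)`. -/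
def Jbeta (q a b c d : ℂ) (n : ℕ) : ℂ :=
  q ^ n * ((a * (b + d) + c * (b + 1)) * (1 + d * q ^ (2 * n + 1)) -
      (c * (b + d) + a * d * (b + 1)) * (1 + q) * q ^ n) /
    ((1 - d * q ^ (2 * n)) * (1 - d * q ^ (2 * n + 2)))

/-- Recurrence coefficient `γ_n` for `J_n(·;a,b,c,d|q)`:
`γ_{n+1} = −q^n(1−q^{n+1})(1−bq^{n+1})(1−dq^{n+1})(a−cq^{n+1})(b−dq^{n+1})(c−adq^{n+1}) /
((1−dq^{2n+1})(1−dq^{2n+2})²(1−dq^{2n+3}))`. -/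
def Jgamma (q a b c d : ℂ) (n : ℕ) : ℂ :=
  -(q ^ (n - 1) * (1 - q ^ n) * (1 - b * q ^ n) * (1 - d * q ^ n) * (a - c * q ^ n) *
      (b - d * q ^ n) * (c - a * d * q ^ n)) /
    ((1 - d * q ^ (2 * n - 1)) * (1 - d * q ^ (2 * n)) ^ 2 * (1 - d * q ^ (2 * n + 1)))

/-- The monic OPS `(J_n(·;a,b,c,d|q))_{n≥0}`. -/
def Jpoly (q a b c d : ℂ) : ℕ → Polynomial ℂ := ttrSeq (Jbeta q a b c d) (Jgamma q a b c d)

end DiscreteCoherent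
namespace DiscreteCoherent

/-- The division defining `hahnD` is exact. -/
lemma C_mul_X_sub_C_mul_hahnD {q ω ω₀ : ℂ} (hq1 : q ≠ 1) (hω₀ : ω₀ = ω / (1 - q))
    (f : Polynomial ℂ) :
    C (q - 1) * ((X - C ω₀) * hahnD q ω f) = f.comp (C q * X + C ω) - f := by
  have h1 : q - 1 ≠ 0 := sub_ne_zero.2 hq1
  have h2 : 1 - q ≠ 0 := sub_ne_zero.2 hq1.symm
  have hfix : q * ω₀ + ω = ω₀ := by
    rw [hω₀]; field_simp; ring
  have hroot : (f.comp (C q * X + C ω) - f).IsRoot ω₀ := by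
    simp [IsRoot, eval_comp, hfix]
  have hdiv := mul_divByMonic_eq_iff_isRoot.2 hroot
  rw [hahnD, ← hω₀, smul_eq_C_mul, mul_left_comm (X - C ω₀), ← mul_assoc (C (q - 1)),
    ← C_mul, mul_inv_cancel₀ h1, C_1, one_mul, hdiv]

/-- The Hahn operator applied to a three-term recurrence centred at the fixed point `ω₀`. -/
lemma hahnD_three_term {q ω ω₀ : ℂ} (hq1 : q ≠ 1) (hω₀ : ω₀ = ω / (1 - q))
    {f g h : Polynomial ℂ} {b t : ℂ} (hf : f = (X - C ω₀) * g - C b * g - C t * h) :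
    hahnD q ω f = (C q * (X - C ω₀) - C b) * hahnD q ω g + g - C t * hahnD q ω h := by
  have h1 : q - 1 ≠ 0 := sub_ne_zero.2 hq1
  have h2 : 1 - q ≠ 0 := sub_ne_zero.2 hq1.symm
  have hω : ω = ω₀ * (1 - q) := by rw [hω₀]; field_simp
  have key := C_mul_X_sub_C_mul_hahnD hq1 hω₀
  have hcomp : f.comp (C q * X + C ω) =
      (C q * (X - C ω₀) - C b) * g.comp (C q * X + C ω) - C t * h.comp (C q * X + C ω) := by
    rw [hf]
    simp only [sub_comp, mul_comp, X_comp, C_comp]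
    rw [hω]
    simp only [C_mul, C_sub, C_1]
    ring
  have hC : C (q - 1) * (X - C ω₀) ≠ 0 := mul_ne_zero (C_ne_zero.2 h1) (X_sub_C_ne_zero _)
  apply mul_left_cancel₀ hC
  have kf := key f
  rw [hcomp] at kf
  have hC1 : C (q - 1) = C q - 1 := by simp
  have kg := key g
  have kh := key h
  rw [hC1] at kf kg kh ⊢
  linear_combination kf - (C q * (X - C ω₀) - C b) * kg + C t * kh - hf

lemma hahnD_one (q ω : ℂ) : hahnD q ω 1 = 0 := by
  simp [hahnD]

/-- Four consecutive members of an orthogonal polynomial sequence are linearly independent. -/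
lemma IsMonicOPS.coeff_eq_zero {u : PolyFun} {P : ℕ → Polynomial ℂ} (hu : IsMonicOPS u P)
    {n : ℕ} {a₃ a₂ a₁ a₀ : ℂ}
    (h : C a₃ * P (n + 3) + C a₂ * P (n + 2) + C a₁ * P (n + 1) + C a₀ * P n = 0) :
    a₃ = 0 ∧ a₂ = 0 ∧ a₁ = 0 ∧ a₀ = 0 := by
  have key : ∀ k, a₃ * u (P (n + 3) * P k) + a₂ * u (P (n + 2) * P k) +
      a₁ * u (P (n + 1) * P k) + a₀ * u (P n * P k) = 0 := by
    intro k
    have := congrArg (fun f => u (f * P k)) h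
    simp only [← smul_eq_C_mul, add_mul, smul_mul_assoc, hu.lin.map_add, hu.lin.map_smul,
      zero_mul, hu.lin.map_zero, smul_eq_mul] at this
    exact this
  have hne : ∀ k, u (P k * P k) ≠ 0 := fun k => by
    rw [← sq]; exact hu.sq_ne k
  refine ⟨?_, ?_, ?_, ?_⟩
  · have := key (n + 3)
    rw [hu.orth (n + 2) _ (by omega), hu.orth (n + 1) _ (by omega), hu.orth n _ (by omega)] at this
    simpa [hne] using this
  · have := key (n + 2)
    rw [hu.orth (n + 3) _ (by omega), hu.orth (n + 1) _ (by omega), hu.orth n _ (by omega)] at this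
    simpa [hne] using this
  · have := key (n + 1)
    rw [hu.orth (n + 3) _ (by omega), hu.orth (n + 2) _ (by omega), hu.orth n _ (by omega)] at this
    simpa [hne] using this
  · have := key n
    rw [hu.orth (n + 3) _ (by omega), hu.orth (n + 2) _ (by omega),
      hu.orth (n + 1) _ (by omega)] at this
    simpa [hne] using this

lemma qNum_zero (q : ℂ) : qNum q 0 = 0 := by simp [qNum]

lemma qNum_succ {q : ℂ} (hq1 : q ≠ 1) (n : ℕ) : qNum q (n + 1) = q * qNum q n + 1 := by
  have h1 : q - 1 ≠ 0 := sub_ne_zero.2 hq1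
  rw [qNum, qNum]; field_simp; ring

lemma sub_one_mul_qNum {q : ℂ} (hq1 : q ≠ 1) (n : ℕ) : (q - 1) * qNum q n = q ^ n - 1 := by
  have h1 : q - 1 ≠ 0 := sub_ne_zero.2 hq1
  rw [qNum]; field_simp

/-- The compatibility conditions between the recurrence coefficients `b`, `γ` (centred at `ω₀`)
and the structure coefficients `e`, `f`. -/
structure Compat (q r s : ℂ) (b γ e f : ℕ → ℂ) : Prop where
  e_zero : e 0 = 0
  e_succ : ∀ n, e (n + 1) = q * (qNum q n * b (n + 1) + e n) - b n * qNum q n +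
    b (n + 1) + b n - (r + s)
  f_one : f 1 = γ 1 + (b 0 - r) * (b 0 - s)
  f_succ : ∀ m, f (m + 2) = q * (qNum q (m + 1) * γ (m + 2) + e (m + 1) * b (m + 1) + f (m + 1)) -
    b (m + 1) * e (m + 1) + γ (m + 2) + γ (m + 1) + (b (m + 1) - r) * (b (m + 1) - s) -
    γ (m + 1) * qNum q m
  lower : ∀ m, q * (e (m + 1) * γ (m + 1) + f (m + 1) * b m) - b (m + 1) * f (m + 1) +
    γ (m + 1) * (b (m + 1) + b m - (r + s) - e m) = 0
  lowest : ∀ m, q * f (m + 2) * γ (m + 1) + γ (m + 2) * γ (m + 1) - γ (m + 2) * f (m + 1) = 0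

lemma compat_of_structure {q ω ω₀ r s : ℂ} (hq1 : q ≠ 1) (hω₀ : ω₀ = ω / (1 - q))
    {u : PolyFun} {P : ℕ → Polynomial ℂ} (hu : IsMonicOPS u P) {b γ e f : ℕ → ℂ}
    (hP0 : P 0 = 1) (he : e 0 = 0)
    (h0 : (X - C ω₀) * P 0 = P 1 + C (b 0) * P 0)
    (hrec : ∀ n, (X - C ω₀) * P (n + 1) =
      P (n + 2) + C (b (n + 1)) * P (n + 1) + C (γ (n + 1)) * P n)
    (hrel : ∀ n, (X - C ω₀ - C r) * (X - C ω₀ - C s) * hahnD q ω (P (n + 1)) =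
      C (qNum q (n + 1)) * P (n + 2) + C (e (n + 1)) * P (n + 1) + C (f (n + 1)) * P n) :
    Compat q r s b γ e f := by
  have hD0 : hahnD q ω (P 0) = 0 := by rw [hP0, hahnD_one]
  have hD1 : hahnD q ω (P 1) = P 0 := by
    have := hahnD_three_term (f := P 1) (g := P 0) (h := 0) (b := b 0) (t := 0) hq1 hω₀
      (by simp only [C_0]; linear_combination -h0)
    rw [this, hD0]; simp
  have hD : ∀ n, hahnD q ω (P (n + 2)) = (C q * (X - C ω₀) - C (b (n + 1))) *
      hahnD q ω (P (n + 1)) + P (n + 1) - C (γ (n + 1)) * hahnD q ω (P n) := fun n =>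
    hahnD_three_term hq1 hω₀ (by linear_combination -hrec n)
  have hq1' : qNum q 1 = 1 := by rw [qNum_succ hq1, qNum_zero]; ring
  have A := hu.coeff_eq_zero (n := 0) (a₃ := 0) (a₂ := 0) (a₁ := e 1 - b 1 - b 0 + (r + s))
    (a₀ := f 1 - γ 1 - (b 0 - r) * (b 0 - s)) (by
      have h := hrel 0
      simp only [zero_add, hq1', hD1] at h ⊢
      have h1 := hrec 0
      simp only [zero_add] at h1
      simp only [C_0, C_1, C_add, C_sub, C_mul] at *
      linear_combination -h + (X - C ω₀ - C r - C s + C (b 0)) * h0 + h1)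
  have B := hu.coeff_eq_zero (n := 0) (a₃ := 0)
    (a₂ := q * (qNum q 1 * b 2 + e 1) - b 1 * qNum q 1 + b 2 + b 1 - (r + s) - e 2)
    (a₁ := q * (qNum q 1 * γ 2 + e 1 * b 1 + f 1) - b 1 * e 1 + γ 2 + γ 1 +
      (b 1 - r) * (b 1 - s) - f 2)
    (a₀ := q * (e 1 * γ 1 + f 1 * b 0) - b 1 * f 1 + γ 1 * (b 1 + b 0 - (r + s))) (by
      have d := hD 0
      have k1 := hrel 0
      have k2 := hrel 1
      have r1 := hrec 0
      have r2 := hrec 1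
      have hn : C (qNum q 2) = C q * C (qNum q 1) + 1 := by rw [qNum_succ hq1 1]; simp
      simp only [zero_add, Nat.reduceAdd, hD0] at *
      simp only [C_0, C_add, C_sub, C_mul] at *
      rw [hn] at k2
      linear_combination k2 - (X - C ω₀ - C r) * (X - C ω₀ - C s) * d -
        (C q * (X - C ω₀) - C (b 1)) * k1 - C q * C (qNum q 1) * r2 - C q * C (e 1) * r1
        - C q * C (f 1) * h0 - (X - C ω₀ - C r - C s + C (b 1)) * r1 - r2 - C (γ 1) * h0)
  have F := fun m => hu.coeff_eq_zero (n := m)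
    (a₃ := q * (qNum q (m + 2) * b (m + 3) + e (m + 2)) - b (m + 2) * qNum q (m + 2) +
      b (m + 3) + b (m + 2) - (r + s) - e (m + 3))
    (a₂ := q * (qNum q (m + 2) * γ (m + 3) + e (m + 2) * b (m + 2) + f (m + 2)) -
      b (m + 2) * e (m + 2) + γ (m + 3) + γ (m + 2) + (b (m + 2) - r) * (b (m + 2) - s) -
      γ (m + 2) * qNum q (m + 1) - f (m + 3))
    (a₁ := q * (e (m + 2) * γ (m + 2) + f (m + 2) * b (m + 1)) - b (m + 2) * f (m + 2) +
      γ (m + 2) * (b (m + 2) + b (m + 1) - (r + s) - e (m + 1)))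
    (a₀ := q * f (m + 2) * γ (m + 1) + γ (m + 2) * γ (m + 1) - γ (m + 2) * f (m + 1)) (by
      have d := hD (m + 1)
      have k0 := hrel m
      have k1 := hrel (m + 1)
      have k2 := hrel (m + 2)
      have r0 := hrec m
      have r1 := hrec (m + 1)
      have r2 := hrec (m + 2)
      have hn : C (qNum q (m + 3)) = C q * C (qNum q (m + 2)) + 1 := by
        rw [qNum_succ hq1 (m + 2)]; simp
      simp only [add_assoc, Nat.reduceAdd] at *
      simp only [C_add, C_sub, C_mul] at *
      rw [hn] at k2
      linear_combination k2 - (X - C ω₀ - C r) * (X - C ω₀ - C s) * d -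
        (C q * (X - C ω₀) - C (b (m + 2))) * k1 + C (γ (m + 2)) * k0 -
        C q * C (qNum q (m + 2)) * r2 - C q * C (e (m + 2)) * r1 - C q * C (f (m + 2)) * r0 -
        (X - C ω₀ - C r - C s + C (b (m + 2))) * r1 - r2 - C (γ (m + 2)) * r0)
  refine ⟨he, ?_, ?_, ?_, ?_, ?_⟩
  · rintro (_ | _ | m)
    · simp only [zero_add, qNum_zero, he]
      linear_combination A.2.2.1
    · linear_combination -B.2.1
    · linear_combination -(F m).1
  · linear_combination A.2.2.2
  · rintro (_ | m)
    · simp only [zero_add, qNum_zero]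
      linear_combination -B.2.2.1
    · linear_combination -(F m).2.1
  · rintro (_ | m)
    · simp only [zero_add, he]
      linear_combination B.2.2.2
    · linear_combination (F m).2.2.1
  · exact fun m => (F m).2.2.2

namespace Compat

variable {q r s : ℂ} {b γ e f : ℕ → ℂ}

lemma f_eq (h : Compat q r s b γ e f) (hq0 : q ≠ 0)
    (hγ : ∀ n, γ (n + 1) ≠ 0) (h1 : (1 - q) * f 1 = γ 1) (n : ℕ) :
    (1 - q) * f (n + 1) = γ (n + 1) := by
  induction n with
  | zero => exact h1
  | succ n ih =>
    apply mul_left_cancel₀ (mul_ne_zero hq0 (hγ n))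
    linear_combination (1 - q) * h.lowest n + γ (n + 2) * ih

lemma e_eq (h : Compat q r s b γ e f) (hq0 : q ≠ 0)
    (hγ : ∀ n, γ (n + 1) ≠ 0) (h1 : (1 - q) * f 1 = γ 1) (n : ℕ) :
    (q - 1) * e n = r + s - q * (r + s - b 0) * q⁻¹ ^ (n + 1) - b n := by
  induction n with
  | zero => rw [h.e_zero]; simp only [zero_add, pow_one]; field_simp; ring
  | succ n ih =>
    have hf := h.f_eq hq0 hγ h1 n
    have hq : q * q⁻¹ ^ (n + 2) = q⁻¹ ^ (n + 1) := by rw [pow_succ]; field_simp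
    apply mul_left_cancel₀ (mul_ne_zero hq0 (hγ n))
    linear_combination (q - 1) * h.lower n + γ (n + 1) * ih +
      (q * b n - b (n + 1)) * hf + γ (n + 1) * q * (r + s - b 0) * hq

lemma b_eq (h : Compat q r s b γ e f) (hq0 : q ≠ 0) (hq1 : q ≠ 1)
    (hγ : ∀ n, γ (n + 1) ≠ 0) (h1 : (1 - q) * f 1 = γ 1) (n : ℕ) :
    b n = Lbeta q⁻¹ r s (q * (r + s - b 0)) n := by
  induction n with
  | zero => simp only [Lbeta, zero_add, pow_one, pow_zero]; field_simp; ring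
  | succ n ih =>
    have e0 := h.e_eq hq0 hγ h1 n
    have e1 := h.e_eq hq0 hγ h1 (n + 1)
    have hs := h.e_succ n
    have hN := sub_one_mul_qNum hq1 n
    have hqn : q ^ n * q⁻¹ ^ n = 1 := by rw [← mul_pow, mul_inv_cancel₀ hq0, one_pow]
    have hqq : q * q⁻¹ = 1 := mul_inv_cancel₀ hq0
    simp only [Lbeta, pow_succ] at *
    generalize hc : q * (r + s - b 0) = c at *
    generalize q⁻¹ ^ n = T at *
    generalize q ^ n = y at *
    generalize q⁻¹ = Q at *
    have hstep : q * y * b (n + 1) = y * b n + c * T * (1 - Q ^ 2) := by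
      linear_combination -(q - 1) * hs + e1 - q * e0 - (q * b (n + 1) - b n) * hN + c * T * hqq
    apply mul_left_cancel₀ (mul_ne_zero hq0 (left_ne_zero_of_mul_eq_one hqn))
    rw [hstep, ih]
    have hy : y ≠ 0 := left_ne_zero_of_mul_eq_one hqn
    have hT : T = y⁻¹ := by rw [eq_inv_of_mul_eq_one_right hqn]
    have hQ : Q = q⁻¹ := by rw [eq_inv_of_mul_eq_one_right hqq]
    rw [hT, hQ]
    field_simp
    ring

lemma γ_eq (h : Compat q r s b γ e f) (hq0 : q ≠ 0) (hq1 : q ≠ 1)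
    (hγ : ∀ n, γ (n + 1) ≠ 0) (h1 : (1 - q) * f 1 = γ 1) (n : ℕ) :
    γ (n + 1) = Lgamma q⁻¹ r s (q * (r + s - b 0)) (n + 1) := by
  induction n with
  | zero =>
    have := h.f_one
    simp only [Lgamma, zero_add, pow_one, Nat.sub_self, pow_zero]
    apply mul_left_cancel₀ hq0
    field_simp
    linear_combination (1 - q) * this - h1
  | succ n ih =>
    have e0 := h.e_eq hq0 hγ h1 (n + 1)
    have b0 := h.b_eq hq0 hq1 hγ h1 (n + 1)
    have f0 := h.f_eq hq0 hγ h1 n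
    have f1 := h.f_eq hq0 hγ h1 (n + 1)
    have hs := h.f_succ n
    have hN := sub_one_mul_qNum hq1 n
    have hN1 := sub_one_mul_qNum hq1 (n + 1)
    have hqn : q ^ n * q⁻¹ ^ n = 1 := by rw [← mul_pow, mul_inv_cancel₀ hq0, one_pow]
    have hqq : q * q⁻¹ = 1 := mul_inv_cancel₀ hq0
    simp only [Lbeta, Lgamma, pow_succ, Nat.add_sub_cancel] at *
    generalize hc : q * (r + s - b 0) = c at *
    generalize q⁻¹ ^ n = T at *
    generalize q ^ n = y at *
    generalize q⁻¹ = Q at *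
    have hstep : q ^ 2 * y * γ (n + 2) =
        y * γ (n + 1) - (q - 1) * (r * s - c * Q ^ 2 * T * b (n + 1)) := by
      linear_combination -(q - 1) * hs - f1 + q * f0 - (q - 1) * b (n + 1) * e0 -
        q * γ (n + 2) * hN1 + γ (n + 1) * hN
    have hy : y ≠ 0 := left_ne_zero_of_mul_eq_one hqn
    have hT : T = y⁻¹ := by rw [eq_inv_of_mul_eq_one_right hqn]
    have hQ : Q = q⁻¹ := by rw [eq_inv_of_mul_eq_one_right hqq]
    apply mul_left_cancel₀ (mul_ne_zero (pow_ne_zero 2 hq0) hy)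
    rw [hstep, ih, b0, hT, hQ]
    field_simp
    ring

end Compat

lemma ttrSeq_comp_eq {b γ : ℕ → ℂ} {ω₀ : ℂ} {P : ℕ → Polynomial ℂ} (hP0 : P 0 = 1)
    (h0 : (X - C ω₀) * P 0 = P 1 + C (b 0) * P 0)
    (hrec : ∀ n, (X - C ω₀) * P (n + 1) =
      P (n + 2) + C (b (n + 1)) * P (n + 1) + C (γ (n + 1)) * P n) :
    ∀ n, P n = (ttrSeq b γ n).comp (X - C ω₀)
  | 0 => by simp [ttrSeq, hP0]
  | 1 => by
    rw [hP0] at h0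
    simp only [ttrSeq, sub_comp, X_comp, C_comp]
    linear_combination -h0
  | n + 2 => by
    simp only [ttrSeq, sub_comp, mul_comp, X_comp, C_comp]
    rw [← ttrSeq_comp_eq hP0 h0 hrec n, ← ttrSeq_comp_eq hP0 h0 hrec (n + 1)]
    linear_combination -hrec n


/-- **Case N = 2 of Theorem 3.1, sub-case III.a.** Under the structure relation
`π₂(x) D_{q,ω}P_{n+1} = [n+1]_q (P_{n+2} + c_{n,n+1}P_{n+1} + c_{n,n}P_n)` with
`c_{n,n} ≠ 0`, if `α = 1/(1 − q⁻¹)` then, with `c = (q−1)β + q(r+s)`,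
`P_n(x) = L_n(x − ω₀; r, s, c | q⁻¹)`. -/
theorem case_N_two_constant_dn (q ω : ℂ) (hq0 : q ≠ 0)
    (hq : ∀ n : ℕ, 1 ≤ n → q ^ n ≠ 1)
    (u : PolyFun) (P : ℕ → Polynomial ℂ) (hu : IsMonicOPS u P)
    (β γ : ℕ → ℂ) (hγ : ∀ n, 1 ≤ n → γ n ≠ 0)
    (hrec0 : X * P 0 = P 1 + C (β 0) * P 0)
    (hrec : ∀ n, X * P (n + 1) = P (n + 2) + C (β (n + 1)) * P (n + 1) + C (γ (n + 1)) * P n)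
    (ω₀ : ℂ) (hω₀ : ω₀ = ω / (1 - q))
    (r s : ℂ) (π₂ : Polynomial ℂ) (hπ₂ : π₂ = (X - C (ω₀ + r)) * (X - C (ω₀ + s)))
    (cn1 cn0 : ℕ → ℂ) (hcn0 : ∀ n, cn0 n ≠ 0)
    (hrel : ∀ n, π₂ * hahnD q ω (P (n + 1)) =
      qNum q (n + 1) • (P (n + 2) + cn1 n • P (n + 1) + cn0 n • P n))
    (α βc : ℂ) (hα : α = -q * (γ 1 + π₂.eval (β 0)) / γ 1)
    (hβc : βc = -α * (β 0 - ω₀))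
    (hconst : α = 1 / (1 - q⁻¹))
    (c : ℂ) (hc : c = (q - 1) * βc + q * (r + s)) :
    ∀ n, P n = (Lpoly q⁻¹ r s c n).comp (X - C ω₀) := by
  have hq1 : q ≠ 1 := by simpa using hq 1 le_rfl
  have hP0 : P 0 = 1 := (hu.monic 0).natDegree_eq_zero.1 (hu.natDegree_eq 0)
  have h0 : (X - C ω₀) * P 0 = P 1 + C (β 0 - ω₀) * P 0 := by
    rw [C_sub]; linear_combination hrec0
  have hrec' : ∀ n, (X - C ω₀) * P (n + 1) =
      P (n + 2) + C (β (n + 1) - ω₀) * P (n + 1) + C (γ (n + 1)) * P n := fun n => by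
    rw [C_sub]; linear_combination hrec n
  have hγ' : ∀ n, γ (n + 1) ≠ 0 := fun n => hγ _ n.succ_pos
  have hcompat : Compat q r s (fun n => β n - ω₀) γ (fun n => qNum q n * cn1 (n - 1))
      (fun n => qNum q n * cn0 (n - 1)) := by
    refine compat_of_structure hq1 hω₀ hu hP0 (by simp [qNum_zero]) h0 hrec' fun n => ?_
    have h := hrel n
    rw [hπ₂] at h
    simp only [smul_eq_C_mul, C_add, C_mul, Nat.add_sub_cancel] at h ⊢
    linear_combination h
  have hqs : q - 1 ≠ 0 := sub_ne_zero.2 hq1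
  have hα' : α = q / (q - 1) := by
    have h : 1 - q⁻¹ = (q - 1) / q := by field_simp
    rw [hconst, h, one_div_div]
  have h1 : (1 - q) * (qNum q 1 * cn0 (1 - 1)) = γ 1 := by
    have hf := hcompat.f_one
    have hg := hγ' 0
    simp only [zero_add] at hg
    rw [hf]
    rw [hα', hπ₂] at hα
    simp only [eval_mul, eval_sub, eval_X, eval_C] at hα
    field_simp at hα
    linear_combination -hα
  have hc' : c = q * (r + s - (β 0 - ω₀)) := by
    rw [hc, hβc, hα']; field_simp; ring
  refine ttrSeq_comp_eq hP0 ?_ fun n => ?_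
  · rw [hc', ← hcompat.b_eq hq0 hq1 hγ' h1 0]
    exact h0
  · rw [hc', ← hcompat.b_eq hq0 hq1 hγ' h1 (n + 1), ← hcompat.γ_eq hq0 hq1 hγ' h1 n]
    exact hrec' n

end DiscreteCoherent
end
end
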